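/- arXiv:1910.08782 — 2 statements merged into one kernel-verified Lean document; each statement's English description precedes it below -/
import Mathlib

section
/- (Theta-block identity for the lattice L₄) For every τ ∈ ℍ and all z₁, z₂, z₃, z₄ ∈ ℂ, writing ϑ(w) for ϑ(τ,w), one has η(τ)^{−6}·ϑ(2z₁+z₂+z₃+z₄)ϑ(z₂−z₃)ϑ(z₂+z₃)ϑ(z₂−z₄)ϑ(z₂+z₄)ϑ(z₃−z₄)ϑ(z₃+z₄)ϑ(z₂)ϑ(z₃)ϑ(z₄) = η(τ)^{−6}·ϑ(z₁+z₂+z₃+z₄)ϑ(z₂−z₃)ϑ(z₂+z₃)ϑ(z₂−z₄)ϑ(z₂+z₄)ϑ(z₃−z₄)ϑ(z₃+z₄)ϑ(z₁+z₂)ϑ(z₁+z₃)ϑ(z₁+z₄) − η(τ)^{−6}·ϑ(z₁)ϑ(z₂−z₃)ϑ(z₂+z₃)ϑ(z₂−z₄)ϑ(z₂+z₄)ϑ(z₃−z₄)ϑ(z₃+z₄)ϑ(z₁+z₂+z₃)ϑ(z₁+z₂+z₄)ϑ(z₁+z₃+z₄). -/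
open Complex

/-- The odd Jacobi theta function
`ϑ(τ,z) = e^{πiτ/4}(e^{πiz} − e^{−πiz}) ∏_{n≥1} (1−qⁿe^{2πiz})(1−qⁿe^{−2πiz})(1−qⁿ)`,
where `q = e^{2πiτ}`. -/
noncomputable def jTheta (τ z : ℂ) : ℂ :=
  Complex.exp (Real.pi * Complex.I * τ / 4) *
    (Complex.exp (Real.pi * Complex.I * z) - Complex.exp (-(Real.pi * Complex.I * z))) *
    ∏' n : ℕ,
      ((1 - Complex.exp (2 * Real.pi * Complex.I * τ) ^ (n + 1) *
            Complex.exp (2 * Real.pi * Complex.I * z)) *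
       (1 - Complex.exp (2 * Real.pi * Complex.I * τ) ^ (n + 1) *
            Complex.exp (-(2 * Real.pi * Complex.I * z))) *
       (1 - Complex.exp (2 * Real.pi * Complex.I * τ) ^ (n + 1)))

/-- The Dedekind eta function `η(τ) = e^{πiτ/12} ∏_{n≥1} (1 − e^{2πinτ})`. -/
noncomputable def dedekindEta (τ : ℂ) : ℂ :=
  Complex.exp (Real.pi * Complex.I * τ / 12) *
    ∏' n : ℕ, (1 - Complex.exp (2 * Real.pi * Complex.I * (n + 1) * τ))

/-- Contour shift for a one-periodic entire function. -/
lemma tb_shift (f : ℂ → ℂ) (hf : Differentiable ℂ f) (hp : ∀ x, f (x + 1) = f x) (τ : ℂ) :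
    ∫ x in (0:ℝ)..1, f (x + τ) = ∫ x in (0:ℝ)..1, f x := by
  have h := integral_boundary_rect_eq_zero_of_differentiableOn f 0 (1 + τ.im * I)
    hf.differentiableOn
  have e1 : ∀ y : ℝ, f (1 + y * I) = f (y * I) := fun y => by
    rw [add_comm]; exact hp _
  simp [e1] at h
  have h2 : ∫ x in (0:ℝ)..1, f x = ∫ x in (0:ℝ)..1, f (x + τ.im * I) := sub_eq_zero.mp h
  rw [h2]
  have hper : Function.Periodic (fun x : ℝ => f (x + τ.im * I)) 1 := fun x => by
    have := hp (x + τ.im * I)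
    simp only [ofReal_add, ofReal_one]
    rw [← this]; congr 1; ring
  have h3 := hper.intervalIntegral_add_eq τ.re 0
  rw [zero_add] at h3
  rw [← h3]
  have h4 := intervalIntegral.integral_comp_add_right (a := 0) (b := 1)
    (fun x : ℝ => f (x + τ.im * I)) τ.re
  rw [zero_add, add_comm (1:ℝ)] at h4
  rw [← h4]
  congr 1
  ext x
  congr 1
  push_cast
  conv_lhs => rw [← re_add_im τ]
  ring

/-- The `n`th Fourier coefficient on the real line. -/
noncomputable def tbCoef (f : ℂ → ℂ) (n : ℤ) : ℂ :=
  ∫ x in (0:ℝ)..1, exp (-(2 * Real.pi * I * n * x)) * f x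

lemma tb_exp_int (n : ℤ) : exp (-(2 * Real.pi * I * n)) = 1 := by
  rw [exp_eq_one_iff]
  exact ⟨-n, by push_cast; ring⟩

lemma tbCoef_rec (f : ℂ → ℂ) (hf : Differentiable ℂ f) (hp : ∀ x, f (x + 1) = f x) (τ : ℂ)
    (ht : ∀ x, f (x + τ) = exp (-(2 * Real.pi * I * (2 * x + τ))) * f x) (n : ℤ) :
    tbCoef f n = exp (-(2 * Real.pi * I * (n + 1) * τ)) * tbCoef f (n + 2) := by
  have h := tb_shift (fun x => exp (-(2 * Real.pi * I * n * x)) * f x) (by fun_prop)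
    (fun x => by
      simp only [hp]
      rw [mul_add, neg_add, exp_add, mul_one, tb_exp_int, mul_one]) τ
  unfold tbCoef
  rw [← h, ← intervalIntegral.integral_const_mul]
  congr 1
  ext x
  rw [ht, ← mul_assoc, ← mul_assoc, ← exp_add, ← exp_add]
  congr 2
  push_cast
  ring

lemma tbCoef_all_zero (f : ℂ → ℂ) (hf : Differentiable ℂ f) (hp : ∀ x, f (x + 1) = f x) (τ : ℂ)
    (ht : ∀ x, f (x + τ) = exp (-(2 * Real.pi * I * (2 * x + τ))) * f x)
    (h0 : tbCoef f 0 = 0) (h1 : tbCoef f 1 = 0) (n : ℤ) : tbCoef f n = 0 := by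
  have key : ∀ n : ℤ, tbCoef f n = 0 ↔ tbCoef f (n + 2) = 0 := fun n => by
    rw [tbCoef_rec f hf hp τ ht n]
    simp [exp_ne_zero]
  have : tbCoef f n = 0 ∧ tbCoef f (n + 1) = 0 := by
    induction n using Int.induction_on with
    | zero => exact ⟨h0, by simpa using h1⟩
    | succ k ih =>
      refine ⟨ih.2, ?_⟩
      have := (key _).1 ih.1
      rwa [add_assoc]
    | pred k ih =>
      refine ⟨(key _).2 ?_, ?_⟩
      · convert ih.2 using 2; ring
      · convert ih.1 using 2; ring
  exact this.1

lemma tb_fourier_zero (f : ℂ → ℂ) (hf : Differentiable ℂ f) (hp : ∀ x, f (x + 1) = f x)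
    (h : ∀ n, tbCoef f n = 0) (z : ℂ) : f z = 0 := by
  have hper : Function.Periodic (fun x : ℝ => f x) 1 := fun x => by simp [hp]
  have : Fact ((0:ℝ) < 1) := ⟨one_pos⟩
  let g : C(AddCircle (1:ℝ), ℂ) := ⟨hper.lift, by
    refine continuous_coinduced_dom.mpr ?_
    exact hf.continuous.comp continuous_ofReal⟩
  have hg : ∀ x : ℝ, g (x : AddCircle (1:ℝ)) = f x := fun x => hper.lift_coe x
  have hc : fourierCoeff g = 0 := by
    ext n
    rw [fourierCoeff_eq_intervalIntegral g n 0]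
    simp only [hg, Pi.zero_apply]
    have := h n
    unfold tbCoef at this
    simp only [zero_add, smul_eq_mul, fourier_coe_apply]
    simp only [div_one, one_smul]
    rw [← this]
    congr 1
    ext x
    congr 2
    push_cast
    ring
  have hr : ∀ x : ℝ, f x = 0 := fun x => by
    have := has_pointwise_sum_fourier_series_of_summable (f := g)
      (by rw [hc]; exact summable_zero) (x : AddCircle (1:ℝ))
    rw [hc, hg] at this
    simp only [Pi.zero_apply, zero_smul] at this
    exact this.unique hasSum_zero
  have ha : AnalyticOnNhd ℂ f Set.univ := fun x _ => hf.analyticAt x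
  have hfreq : ∃ᶠ w in nhdsWithin (0:ℂ) {0}ᶜ, f w = (fun _ => (0:ℂ)) w := by
    have ht : Filter.Tendsto (fun x : ℝ => (x : ℂ)) (nhdsWithin (0:ℝ) {0}ᶜ)
        (nhdsWithin (0:ℂ) {0}ᶜ) := by
      refine tendsto_nhdsWithin_iff.mpr ⟨?_, ?_⟩
      · exact (by simpa using continuous_ofReal.tendsto (0:ℝ) :
          Filter.Tendsto (fun x : ℝ => (x : ℂ)) (nhds 0) (nhds 0)).mono_left nhdsWithin_le_nhds
      · filter_upwards [self_mem_nhdsWithin] with x hx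
        simpa using hx
    refine ht.frequently ?_
    exact (Filter.Eventually.of_forall fun x => hr x).frequently
  have := ha.eq_of_frequently_eq (g := fun _ => (0:ℂ)) (z₀ := 0)
    (fun x _ => analyticAt_const) hfreq
  exact congrFun this z

/-- The basic product. -/
noncomputable def tbP (q u : ℂ) : ℂ := ∏' n : ℕ, (1 - q ^ (n + 1) * u)

lemma tb_mult (q : ℂ) (hq : ‖q‖ < 1) (u : ℂ) : Multipliable fun n : ℕ => (1 - q ^ (n + 1) * u) := by
  have := multipliable_one_add_of_summable (f := fun n : ℕ => -(q ^ (n + 1) * u)) (by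
    simp only [norm_neg, norm_mul, norm_pow]
    exact ((summable_nat_add_iff 1).mpr
      (summable_geometric_of_lt_one (norm_nonneg _) hq)).mul_right _)
  simpa [sub_eq_add_neg] using this

lemma tbP_step (q : ℂ) (hq : ‖q‖ < 1) (u : ℂ) : tbP q u = (1 - q * u) * tbP q (q * u) := by
  unfold tbP
  have e : ∀ n : ℕ, 1 - q ^ (n + 1) * (q * u) = 1 - q ^ (n + 1 + 1) * u := fun n => by ring
  rw [tprod_eq_zero_mul']
  · simp [e]
  · have := tb_mult q hq (q * u)
    simpa only [e] using this

lemma tbP_diff (q : ℂ) (hq : ‖q‖ < 1) : Differentiable ℂ (tbP q) := by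
  intro u₀
  have hs : Summable fun n : ℕ => ‖q‖ ^ (n + 1) * (‖u₀‖ + 1) :=
    ((summable_nat_add_iff 1).mpr (summable_geometric_of_lt_one (norm_nonneg _) hq)).mul_right _
  have H := hs.hasProdLocallyUniformlyOn_nat_one_add
    (f := fun n u => -(q ^ (n + 1) * u)) (K := Metric.ball (0:ℂ) (‖u₀‖ + 1))
    Metric.isOpen_ball
    (.of_forall fun n x hx => by
      simp only [norm_neg, norm_mul, norm_pow]
      have : ‖x‖ < ‖u₀‖ + 1 := by simpa using hx
      gcongr) (fun n => by fun_prop)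
  have D : DifferentiableOn ℂ (fun u => ∏' n : ℕ, (1 + -(q ^ (n + 1) * u)))
      (Metric.ball (0:ℂ) (‖u₀‖ + 1)) :=
    H.differentiableOn (.of_forall fun _ ↦ by
      simpa [Finset.prod_fn] using DifferentiableOn.finsetProd (fun _ _ ↦ by fun_prop))
      Metric.isOpen_ball
  have := D.differentiableAt (Metric.isOpen_ball.mem_nhds (by simp : u₀ ∈ _))
  simp only [← sub_eq_add_neg] at this
  exact this

lemma tb_q (τ : ℂ) (hτ : 0 < τ.im) : ‖exp (2 * Real.pi * I * τ)‖ < 1 :=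
  UpperHalfPlane.norm_exp_two_pi_I_lt_one ⟨τ, hτ⟩

lemma jTheta_eq (τ : ℂ) (hτ : 0 < τ.im) (z : ℂ) :
    jTheta τ z = exp (Real.pi * I * τ / 4) *
      (exp (Real.pi * I * z) - exp (-(Real.pi * I * z))) *
      (tbP (exp (2 * Real.pi * I * τ)) (exp (2 * Real.pi * I * z)) *
       tbP (exp (2 * Real.pi * I * τ)) (exp (-(2 * Real.pi * I * z))) *
       tbP (exp (2 * Real.pi * I * τ)) 1) := by
  have hq := tb_q τ hτ
  have h1 := tb_mult _ hq (exp (2 * Real.pi * I * z))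
  have h2 := tb_mult _ hq (exp (-(2 * Real.pi * I * z)))
  have h3 := tb_mult _ hq 1
  unfold jTheta tbP
  rw [← h1.tprod_mul h2, ← (h1.mul h2).tprod_mul h3]
  simp only [mul_one]

lemma jTheta_diff (τ : ℂ) (hτ : 0 < τ.im) : Differentiable ℂ (jTheta τ) := by
  have h := tbP_diff _ (tb_q τ hτ)
  have : jTheta τ = _ := funext (jTheta_eq τ hτ)
  rw [this]
  fun_prop

lemma jTheta_neg (τ : ℂ) (hτ : 0 < τ.im) (z : ℂ) : jTheta τ (-z) = -jTheta τ z := by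
  rw [jTheta_eq τ hτ, jTheta_eq τ hτ]
  simp only [mul_neg, neg_neg]
  ring

lemma jTheta_one (τ : ℂ) (hτ : 0 < τ.im) (z : ℂ) : jTheta τ (z + 1) = -jTheta τ z := by
  rw [jTheta_eq τ hτ, jTheta_eq τ hτ]
  have e1 : exp (Real.pi * I * (z + 1)) = - exp (Real.pi * I * z) := by
    rw [mul_add, exp_add, mul_one, exp_pi_mul_I]; ring
  have e2 : exp (-(Real.pi * I * (z + 1))) = - exp (-(Real.pi * I * z)) := by
    rw [exp_neg, exp_neg, e1, inv_neg]
  have e3 : exp (2 * Real.pi * I * (z + 1)) = exp (2 * Real.pi * I * z) := by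
    rw [mul_add, exp_add, mul_one, exp_two_pi_mul_I, mul_one]
  have e4 : exp (-(2 * Real.pi * I * (z + 1))) = exp (-(2 * Real.pi * I * z)) := by
    rw [exp_neg, exp_neg, e3]
  rw [e1, e2, e3, e4]
  ring

lemma jTheta_tau (τ : ℂ) (hτ : 0 < τ.im) (z : ℂ) :
    jTheta τ (z + τ) = -exp (-(Real.pi * I * (2 * z + τ))) * jTheta τ z := by
  have hq := tb_q τ hτ
  rw [jTheta_eq τ hτ, jTheta_eq τ hτ]
  set q := exp (2 * Real.pi * I * τ) with hqd
  have hs1 := tbP_step q hq (exp (2 * Real.pi * I * z))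
  have hs2 := tbP_step q hq (exp (-(2 * Real.pi * I * (z + τ))))
  have e1 : exp (2 * Real.pi * I * (z + τ)) = q * exp (2 * Real.pi * I * z) := by
    rw [hqd, ← exp_add]; congr 1; ring
  have e2 : q * exp (-(2 * Real.pi * I * (z + τ))) = exp (-(2 * Real.pi * I * z)) := by
    rw [hqd, ← exp_add]; congr 1; ring
  rw [e2] at hs2
  rw [hs2, e1, hs1]
  set a := exp (Real.pi * I * z) with ha
  set b := exp (Real.pi * I * τ) with hb
  have ha0 : a ≠ 0 := exp_ne_zero _
  have hb0 : b ≠ 0 := exp_ne_zero _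
  have f1 : exp (-(Real.pi * I * z)) = a⁻¹ := exp_neg _
  have f2 : exp (Real.pi * I * (z + τ)) = a * b := by
    rw [ha, hb, ← exp_add]; congr 1; ring
  have f3 : exp (-(Real.pi * I * (z + τ))) = (a * b)⁻¹ := by rw [exp_neg, f2]
  have f4 : exp (2 * Real.pi * I * z) = a ^ 2 := by
    rw [ha, ← exp_nat_mul]; congr 1; push_cast; ring
  have f5 : exp (-(2 * Real.pi * I * z)) = (a ^ 2)⁻¹ := by rw [exp_neg, f4]
  have f6 : q = b ^ 2 := by
    rw [hqd, hb, ← exp_nat_mul]; congr 1; push_cast; ring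
  have f7 : exp (-(Real.pi * I * (2 * z + τ))) = (a ^ 2 * b)⁻¹ := by
    rw [exp_neg, ← f4, hb, ← exp_add]; congr 2; ring
  rw [f1, f2, f3, f4, f5, f7]
  generalize tbP q (q * a ^ 2) = X
  generalize tbP q ((a ^ 2)⁻¹) = Y
  generalize tbP q 1 = Z
  rw [f6]
  field_simp
  ring

lemma tb_exists_ker (P Q : Fin 3 → ℂ) : ∃ l : Fin 3 → ℂ, l ≠ 0 ∧
    l 0 * P 0 + l 1 * P 1 + l 2 * P 2 = 0 ∧ l 0 * Q 0 + l 1 * Q 1 + l 2 * Q 2 = 0 := by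
  obtain ⟨v, hv, h⟩ := (Matrix.exists_mulVec_eq_zero_iff (M := Matrix.of ![P, Q, 0])).mpr
    (Matrix.det_eq_zero_of_row_eq_zero 2 (fun j => rfl))
  refine ⟨v, hv, ?_, ?_⟩
  · have := congrFun h 0
    simp [Matrix.mulVec, dotProduct, Fin.sum_univ_three] at this
    linear_combination this
  · have := congrFun h 1
    simp [Matrix.mulVec, dotProduct, Fin.sum_univ_three] at this
    linear_combination this

/-- Weierstrass three-term identity. -/
lemma tb_weier (τ : ℂ) (hτ : 0 < τ.im) (x y u v : ℂ) :
    jTheta τ (x + y) * jTheta τ (x - y) * (jTheta τ (u + v) * jTheta τ (u - v)) =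
    jTheta τ (x + u) * jTheta τ (x - u) * (jTheta τ (y + v) * jTheta τ (y - v)) -
    jTheta τ (x + v) * jTheta τ (x - v) * (jTheta τ (y + u) * jTheta τ (y - u)) := by
  let K : ℂ → ℂ → ℂ := fun a b => jTheta τ (a + b) * jTheta τ (a - b)
  have hanti : ∀ a b, K b a = -K a b := fun a b => by
    simp only [K]
    rw [← neg_sub a b, jTheta_neg τ hτ, add_comm b a]; ring
  have hdiag : ∀ a, K a a = 0 := fun a => by
    have := hanti a a
    linear_combination this / 2
  have hd := jTheta_diff τ hτ
  have hKd : ∀ b, Differentiable ℂ (fun a => K a b) := fun b => by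
    simp only [K]; fun_prop
  have hK1 : ∀ a b, K (a + 1) b = K a b := fun a b => by
    simp only [K]
    rw [add_right_comm, add_sub_right_comm, jTheta_one τ hτ, jTheta_one τ hτ]; ring
  have hKt : ∀ a b, K (a + τ) b = exp (-(2 * Real.pi * I * (2 * a + τ))) * K a b := fun a b => by
    simp only [K]
    rw [add_right_comm, add_sub_right_comm, jTheta_tau τ hτ, jTheta_tau τ hτ]
    have : exp (-(2 * Real.pi * I * (2 * a + τ))) =
      exp (-(Real.pi * I * (2 * (a + b) + τ))) * exp (-(Real.pi * I * (2 * (a - b) + τ))) := by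
      rw [← exp_add]; congr 1; ring
    rw [this]; ring
  obtain ⟨l, hl, hP, hQ⟩ := tb_exists_ker
    (fun i => tbCoef (fun a => K a (![y, u, v] i)) 0)
    (fun i => tbCoef (fun a => K a (![y, u, v] i)) 1)
  simp at hP hQ
  have hlin : ∀ n, tbCoef (fun a => l 0 * K a y + l 1 * K a u + l 2 * K a v) n =
      l 0 * tbCoef (fun a => K a y) n + l 1 * tbCoef (fun a => K a u) n +
      l 2 * tbCoef (fun a => K a v) n := fun n => by
    unfold tbCoef
    have hi : ∀ b c : ℂ, IntervalIntegrable
        (fun t : ℝ => c * (exp (-(2 * Real.pi * I * n * t)) * K t b)) MeasureTheory.volume 0 1 :=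
      fun b c => by
        have := (hKd b).continuous.comp continuous_ofReal
        simp only [Function.comp_def] at this
        apply Continuous.intervalIntegrable
        refine continuous_const.mul (Continuous.mul ?_ this)
        fun_prop
    rw [← intervalIntegral.integral_const_mul, ← intervalIntegral.integral_const_mul,
      ← intervalIntegral.integral_const_mul, ← intervalIntegral.integral_add (hi _ _) (hi _ _),
      ← intervalIntegral.integral_add ((hi _ _).add (hi _ _)) (hi _ _)]
    congr 1
    ext t
    ring
  have hG : ∀ a, l 0 * K a y + l 1 * K a u + l 2 * K a v = 0 := by
    have hGd : Differentiable ℂ (fun a => l 0 * K a y + l 1 * K a u + l 2 * K a v) :=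
      (((hKd y).const_mul _).add ((hKd u).const_mul _)).add ((hKd v).const_mul _)
    have hG1 : ∀ a, (fun a => l 0 * K a y + l 1 * K a u + l 2 * K a v) (a + 1) =
        (fun a => l 0 * K a y + l 1 * K a u + l 2 * K a v) a := fun a => by simp only [hK1]
    refine tb_fourier_zero _ hGd hG1 (tbCoef_all_zero _ hGd hG1 τ ?_ ?_ ?_)
    · intro a; simp only [hKt]; ring
    · rw [hlin]; exact hP
    · rw [hlin]; exact hQ
  have gx := hG x
  have gy := hG y
  have gu := hG u
  have gv := hG v
  rw [hdiag] at gy gu gv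
  rw [hanti y u] at gu
  rw [hanti y v, hanti u v] at gv
  have goal : K x y * K u v = K x u * K y v - K x v * K y u := by
    by_cases h0 : l 0 = 0
    · by_cases h1 : l 1 = 0
      · have h2 : l 2 ≠ 0 := fun h2 => hl (by ext i; fin_cases i <;> assumption)
        apply mul_left_cancel₀ h2
        rw [h0, h1] at gx gy gu
        linear_combination (K y u) * gx + (K x u) * (-gy) + K x y * gu
      · apply mul_left_cancel₀ h1
        linear_combination (K y v) * (-gx) + (K x v) * gy + K x y * (-gv)
    · apply mul_left_cancel₀ h0
      linear_combination (K u v) * gx - (K x v) * gu + K x u * gv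
  exact goal

/-- Theta-block identity for the lattice `L₄`. -/
theorem theta_block_identity_L4 (τ : ℂ) (hτ : 0 < τ.im) (z₁ z₂ z₃ z₄ : ℂ) :
    dedekindEta τ ^ (-6 : ℤ) *
      (jTheta τ (2 * z₁ + z₂ + z₃ + z₄) * jTheta τ (z₂ - z₃) * jTheta τ (z₂ + z₃) *
        jTheta τ (z₂ - z₄) * jTheta τ (z₂ + z₄) * jTheta τ (z₃ - z₄) * jTheta τ (z₃ + z₄) *
        jTheta τ z₂ * jTheta τ z₃ * jTheta τ z₄) =
    dedekindEta τ ^ (-6 : ℤ) *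
      (jTheta τ (z₁ + z₂ + z₃ + z₄) * jTheta τ (z₂ - z₃) * jTheta τ (z₂ + z₃) *
        jTheta τ (z₂ - z₄) * jTheta τ (z₂ + z₄) * jTheta τ (z₃ - z₄) * jTheta τ (z₃ + z₄) *
        jTheta τ (z₁ + z₂) * jTheta τ (z₁ + z₃) * jTheta τ (z₁ + z₄)) -
    dedekindEta τ ^ (-6 : ℤ) *
      (jTheta τ z₁ * jTheta τ (z₂ - z₃) * jTheta τ (z₂ + z₃) *
        jTheta τ (z₂ - z₄) * jTheta τ (z₂ + z₄) * jTheta τ (z₃ - z₄) * jTheta τ (z₃ + z₄) *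
        jTheta τ (z₁ + z₂ + z₃) * jTheta τ (z₁ + z₂ + z₄) * jTheta τ (z₁ + z₃ + z₄)) := by
  have h := tb_weier τ hτ (z₁ + z₂ + (z₃ + z₄) / 2) (z₁ + (z₃ + z₄) / 2)
    ((z₃ + z₄) / 2) ((z₃ - z₄) / 2)
  rw [show z₁ + z₂ + (z₃ + z₄) / 2 + (z₁ + (z₃ + z₄) / 2) = 2 * z₁ + z₂ + z₃ + z₄ by ring,
    show z₁ + z₂ + (z₃ + z₄) / 2 - (z₁ + (z₃ + z₄) / 2) = z₂ by ring,
    show (z₃ + z₄) / 2 + (z₃ - z₄) / 2 = z₃ by ring,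
    show (z₃ + z₄) / 2 - (z₃ - z₄) / 2 = z₄ by ring,
    show z₁ + z₂ + (z₃ + z₄) / 2 + (z₃ + z₄) / 2 = z₁ + z₂ + z₃ + z₄ by ring,
    show z₁ + z₂ + (z₃ + z₄) / 2 - (z₃ + z₄) / 2 = z₁ + z₂ by ring,
    show z₁ + (z₃ + z₄) / 2 + (z₃ - z₄) / 2 = z₁ + z₃ by ring,
    show z₁ + (z₃ + z₄) / 2 - (z₃ - z₄) / 2 = z₁ + z₄ by ring,
    show z₁ + z₂ + (z₃ + z₄) / 2 + (z₃ - z₄) / 2 = z₁ + z₂ + z₃ by ring,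
    show z₁ + z₂ + (z₃ + z₄) / 2 - (z₃ - z₄) / 2 = z₁ + z₂ + z₄ by ring,
    show z₁ + (z₃ + z₄) / 2 + (z₃ + z₄) / 2 = z₁ + z₃ + z₄ by ring,
    show z₁ + (z₃ + z₄) / 2 - (z₃ + z₄) / 2 = z₁ by ring] at h
  linear_combination (dedekindEta τ ^ (-6 : ℤ) * (jTheta τ (z₂ - z₃) * jTheta τ (z₂ + z₃) *
        jTheta τ (z₂ - z₄) * jTheta τ (z₂ + z₄) * jTheta τ (z₃ - z₄) * jTheta τ (z₃ + z₄))) * h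
end

section
/- (Index-67 example) For every τ ∈ ℍ and z ∈ ℂ, writing ϑ_j for ϑ(τ,jz) (and ϑ for ϑ(τ,z)), one has η(τ)^{−6}·ϑ³ϑ₂²ϑ₃²ϑ₄ϑ₅ϑ₈ = η(τ)^{−6}·ϑ²ϑ₂²ϑ₃²ϑ₄²ϑ₅ϑ₇ − η(τ)^{−6}·ϑ³ϑ₂ϑ₃ϑ₄²ϑ₅²ϑ₆. -/
open Complex

open Filter Topology

noncomputable def qP (q : ℂ) (n : ℕ) : ℂ := ∏ k ∈ Finset.range n, (1 - q ^ (k + 1))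

noncomputable def qC (q : ℂ) (K m : ℕ) : ℂ :=
  if m ≤ K then qP q K / (qP q m * qP q (K - m)) else 0

lemma one_sub_pow_ne {q : ℂ} (hq : ‖q‖ < 1) (k : ℕ) : 1 - q ^ (k + 1) ≠ 0 := by
  intro h
  have h1 : q ^ (k + 1) = 1 := (sub_eq_zero.mp h).symm
  have h2 : ‖q‖ ^ (k + 1) = 1 := by rw [← norm_pow, h1, norm_one]
  have h3 : ‖q‖ ^ (k + 1) < 1 := pow_lt_one₀ (norm_nonneg _) hq (by omega)
  linarith

lemma qP_ne {q : ℂ} (hq : ‖q‖ < 1) (n : ℕ) : qP q n ≠ 0 :=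
  Finset.prod_ne_zero_iff.mpr fun k _ => one_sub_pow_ne hq k

lemma qP_succ (q : ℂ) (n : ℕ) : qP q (n + 1) = qP q n * (1 - q ^ (n + 1)) :=
  Finset.prod_range_succ _ _

lemma qP_zero (q : ℂ) : qP q 0 = 1 := rfl

lemma qC_zero {q : ℂ} (hq : ‖q‖ < 1) (K : ℕ) : qC q K 0 = 1 := by
  simp [qC, qP_zero, qP_ne hq]

lemma qC_self {q : ℂ} (hq : ‖q‖ < 1) (K : ℕ) : qC q K K = 1 := by
  simp [qC, qP_zero, qP_ne hq]

lemma qC_gt (q : ℂ) {K m : ℕ} (h : K < m) : qC q K m = 0 := by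
  simp [qC, not_le.mpr h]

lemma qC_pascal1 {q : ℂ} (hq : ‖q‖ < 1) (K m : ℕ) (hm : m ≤ K) :
    qC q (K + 1) (m + 1) = qC q K (m + 1) + q ^ (K - m) * qC q K m := by
  rcases hm.eq_or_lt with rfl | h
  · simp [qC_self hq, qC_gt]
  · obtain ⟨d, rfl⟩ := Nat.exists_eq_add_of_lt h
    have e1 : m + d + 1 + 1 - (m + 1) = d + 1 := by omega
    have e2 : m + d + 1 - (m + 1) = d := by omega
    have e3 : m + d + 1 - m = d + 1 := by omega
    rw [qC, qC, qC, if_pos (by omega), if_pos (by omega), if_pos (by omega), e1, e2, e3,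
      qP_succ q (m + d + 1), qP_succ q m, qP_succ q d]
    have := qP_ne hq m
    have := qP_ne hq d
    have := one_sub_pow_ne hq m
    have := one_sub_pow_ne hq d
    field_simp
    ring

lemma qC_pascal2 {q : ℂ} (hq : ‖q‖ < 1) (K m : ℕ) (hm : m ≤ K) :
    qC q (K + 1) (m + 1) = q ^ (m + 1) * qC q K (m + 1) + qC q K m := by
  rcases hm.eq_or_lt with rfl | h
  · simp [qC_self hq, qC_gt]
  · obtain ⟨d, rfl⟩ := Nat.exists_eq_add_of_lt h
    have e1 : m + d + 1 + 1 - (m + 1) = d + 1 := by omega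
    have e2 : m + d + 1 - (m + 1) = d := by omega
    have e3 : m + d + 1 - m = d + 1 := by omega
    rw [qC, qC, qC, if_pos (by omega), if_pos (by omega), if_pos (by omega), e1, e2, e3,
      qP_succ q (m + d + 1), qP_succ q m, qP_succ q d]
    have := qP_ne hq m
    have := qP_ne hq d
    have := one_sub_pow_ne hq m
    have := one_sub_pow_ne hq d
    field_simp
    ring

lemma sum_step1 {q : ℂ} (hq : ‖q‖ < 1) (K : ℕ) (s : ℕ → ℂ) :
    ∑ m ∈ Finset.range (K + 2), qC q (K + 1) m * s m =
      ∑ m ∈ Finset.range (K + 1), qC q K m * (s m + q ^ (K - m) * s (m + 1)) := by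
  rw [Finset.sum_range_succ']
  have h : ∑ m ∈ Finset.range (K + 1), qC q (K + 1) (m + 1) * s (m + 1) =
      ∑ m ∈ Finset.range (K + 1), qC q K (m + 1) * s (m + 1) +
      ∑ m ∈ Finset.range (K + 1), qC q K m * (q ^ (K - m) * s (m + 1)) := by
    rw [← Finset.sum_add_distrib]
    refine Finset.sum_congr rfl fun m hm => ?_
    rw [qC_pascal1 hq K m (by simpa [Nat.lt_succ_iff] using hm)]
    ring
  have h2 := Finset.sum_range_succ' (fun m => qC q K m * s m) (K + 1)
  rw [Finset.sum_range_succ, qC_gt q (Nat.lt_succ_self K)] at h2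
  simp only [mul_add, Finset.sum_add_distrib, h, qC_zero hq] at h2 ⊢
  linear_combination -h2

lemma sum_step2 {q : ℂ} (hq : ‖q‖ < 1) (K : ℕ) (s : ℕ → ℂ) :
    ∑ m ∈ Finset.range (K + 2), qC q (K + 1) m * s m =
      ∑ m ∈ Finset.range (K + 1), qC q K m * (q ^ m * s m + s (m + 1)) := by
  rw [Finset.sum_range_succ']
  have h : ∑ m ∈ Finset.range (K + 1), qC q (K + 1) (m + 1) * s (m + 1) =
      ∑ m ∈ Finset.range (K + 1), qC q K (m + 1) * (q ^ (m + 1) * s (m + 1)) +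
      ∑ m ∈ Finset.range (K + 1), qC q K m * s (m + 1) := by
    rw [← Finset.sum_add_distrib]
    refine Finset.sum_congr rfl fun m hm => ?_
    rw [qC_pascal2 hq K m (by simpa [Nat.lt_succ_iff] using hm)]
    ring
  have h2 := Finset.sum_range_succ' (fun m => qC q K m * (q ^ m * s m)) (K + 1)
  rw [Finset.sum_range_succ, qC_gt q (Nat.lt_succ_self K)] at h2
  simp only [mul_add, Finset.sum_add_distrib, h, qC_zero hq] at h2 ⊢
  linear_combination -h2

lemma finite_triple {q ζ : ℂ} (hq : ‖q‖ < 1) (q0 : q ≠ 0) (ζ0 : ζ ≠ 0) (t : ℤ → ℂ)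
    (t0 : t 0 = 1) (ht : ∀ j : ℤ, t (j + 1) = -(q ^ (j + 1)) * ζ * t j) (N M : ℕ) :
    (∏ n ∈ Finset.range N, (1 - q ^ (n + 1) * ζ)) * (∏ n ∈ Finset.range M, (1 - q ^ n * ζ⁻¹)) =
      ∑ m ∈ Finset.range (N + M + 1), qC q (N + M) m * t ((m : ℤ) - M) := by
  induction M with
  | zero =>
    induction N with
    | zero => simp [qC_zero hq, t0]
    | succ N ih =>
      simp only [Finset.prod_range_zero, mul_one, add_zero, Nat.cast_zero, sub_zero] at ih ⊢
      rw [Finset.prod_range_succ, ih, sum_step1 hq N (fun m => t (m : ℤ)), Finset.sum_mul]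
      refine Finset.sum_congr rfl fun m hm => ?_
      have hm' : m ≤ N := by simpa [Nat.lt_succ_iff] using hm
      push_cast
      rw [ht m]
      have : q ^ (N + 1) = q ^ (N - m) * q ^ ((m : ℤ) + 1) := by
        rw [show ((m : ℤ) + 1) = ((m + 1 : ℕ) : ℤ) by push_cast; rfl, zpow_natCast, ← pow_add]
        congr 1; omega
      rw [this]; ring
  | succ M ih =>
    rw [Finset.prod_range_succ, ← mul_assoc, ih, ← add_assoc,
      sum_step2 hq (N + M) (fun m => t ((m : ℤ) - (M + 1 : ℕ))), Finset.sum_mul]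
    refine Finset.sum_congr rfl fun m hm => ?_
    have h := ht ((m : ℤ) - (M + 1 : ℕ))
    have e1 : (m : ℤ) - (M + 1 : ℕ) + 1 = m - M := by push_cast; ring
    have e2 : ((m + 1 : ℕ) : ℤ) - (M + 1 : ℕ) = m - M := by push_cast; ring
    rw [e1] at h
    rw [e2, mul_assoc]
    congr 1
    have e3 : q ^ M * q ^ ((m : ℤ) - M) = q ^ m := by
      rw [← zpow_natCast q M, ← zpow_natCast q m, ← zpow_add₀ q0]; congr 1; ring
    rw [← e3]
    have e4 : ζ⁻¹ * ζ = 1 := inv_mul_cancel₀ ζ0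
    linear_combination (-q ^ M * ζ⁻¹) * h + (q ^ M * q ^ ((m : ℤ) - M) *
      t ((m : ℤ) - (M + 1 : ℕ))) * e4

lemma mult_one_sub {q : ℂ} (hq : ‖q‖ < 1) (w : ℂ) :
    Multipliable fun n : ℕ => 1 - q ^ (n + 1) * w := by
  have := multipliable_one_add_of_summable (f := fun n : ℕ => -(q ^ (n + 1) * w)) (by
    simpa using ((summable_nat_add_iff 1).mpr
      (summable_geometric_of_lt_one (norm_nonneg _) hq)).mul_right ‖w‖)
  simpa [sub_eq_add_neg] using this

lemma qP_lim {q : ℂ} (hq : ‖q‖ < 1) : ∃ Q : ℂ, Q ≠ 0 ∧ Tendsto (qP q) atTop (𝓝 Q) := by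
  have hm := mult_one_sub hq 1
  simp only [mul_one] at hm
  refine ⟨_, ?_, hm.tendsto_prod_tprod_nat⟩
  have := tprod_one_add_ne_zero_of_summable (f := fun n : ℕ => -(q ^ (n + 1)))
    (fun i => by simpa [sub_eq_add_neg] using one_sub_pow_ne hq i) (by
      simpa using ((summable_nat_add_iff 1).mpr
      (summable_geometric_of_lt_one (norm_nonneg _) hq)))
  simpa [sub_eq_add_neg] using this

/-- the coefficient at stage N -/
noncomputable def dC (q : ℂ) (N : ℕ) (j : ℤ) : ℂ :=
  if 0 ≤ j + (N + 1) then qP q N * qC q (2 * N + 1) (j + (N + 1)).toNat else 0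

lemma dC_bound {q : ℂ} (hq : ‖q‖ < 1) : ∃ B : ℝ, ∀ N j, ‖dC q N j‖ ≤ B := by
  obtain ⟨Q, Q0, hQ⟩ := qP_lim hq
  obtain ⟨B, hB⟩ := (Metric.isBounded_range_of_tendsto _ hQ).exists_norm_le
  obtain ⟨D, hD⟩ := (Metric.isBounded_range_of_tendsto _ (hQ.inv₀ Q0)).exists_norm_le
  have hB' : ∀ n, ‖qP q n‖ ≤ B := fun n => hB _ ⟨n, rfl⟩
  have hD' : ∀ n, ‖(qP q n)⁻¹‖ ≤ D := fun n => hD _ ⟨n, rfl⟩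
  have B0 : 0 ≤ B := (norm_nonneg _).trans (hB' 0)
  have D0 : 0 ≤ D := (norm_nonneg _).trans (hD' 0)
  refine ⟨B * (B * (D * D)), fun N j => ?_⟩
  unfold dC qC
  split_ifs
  · rw [div_eq_mul_inv, mul_inv, norm_mul, norm_mul, norm_mul]
    gcongr <;> first | exact hB' _ | exact hD' _
  · simp; positivity
  · simp; positivity

lemma dC_tendsto {q : ℂ} (hq : ‖q‖ < 1) (j : ℤ) : Tendsto (fun N => dC q N j) atTop (𝓝 1) := by
  obtain ⟨Q, Q0, hQ⟩ := qP_lim hq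
  have h1 : Tendsto (fun N : ℕ => 2 * N + 1) atTop atTop :=
    tendsto_atTop_mono (fun N => by simp only [id]; omega) tendsto_id
  have h2 : Tendsto (fun N : ℕ => (j + (N + 1)).toNat) atTop atTop := by
    refine tendsto_atTop.mpr fun b => ?_
    filter_upwards [eventually_ge_atTop (b + j.natAbs)] with N hN
    omega
  have h3 : Tendsto (fun N : ℕ => 2 * N + 1 - (j + (N + 1)).toNat) atTop atTop := by
    refine tendsto_atTop.mpr fun b => ?_
    filter_upwards [eventually_ge_atTop (b + j.natAbs + 1)] with N hN
    omega
  have h := hQ.mul ((hQ.comp h1).div ((hQ.comp h2).mul (hQ.comp h3)) (mul_ne_zero Q0 Q0))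
  have e : Q * (Q / (Q * Q)) = 1 := by field_simp
  rw [e] at h
  refine h.congr' ?_
  filter_upwards [eventually_ge_atTop (j.natAbs + 1)] with N hN
  simp only [dC, qC, Function.comp]
  rw [if_pos (by omega), if_pos (by omega)]
  rfl

lemma dC_sum (q : ℂ) (N : ℕ) (t : ℤ → ℂ) :
    ∑' j : ℤ, dC q N j * t j =
      qP q N * ∑ m ∈ Finset.range (N + (N + 1) + 1),
        qC q (N + (N + 1)) m * t ((m : ℤ) - (N + 1 : ℕ)) := by
  have hinj : Function.Injective (fun m : ℕ => (m : ℤ) - (N + 1 : ℕ)) := by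
    intro a b h; simp only at h; omega
  rw [← hinj.tsum_eq, tsum_eq_sum (s := Finset.range (N + (N + 1) + 1)), Finset.mul_sum]
  · refine Finset.sum_congr rfl fun m hm => ?_
    simp only [dC]
    rw [if_pos (by push_cast; omega), show ((m : ℤ) - (N + 1 : ℕ) + (N + 1)).toNat = m by
      push_cast; omega, show 2 * N + 1 = N + (N + 1) by ring]
    ring
  · intro m hm
    simp only [Finset.mem_range, not_lt] at hm
    simp only [dC]
    rw [if_pos (by push_cast; omega), show ((m : ℤ) - (N + 1 : ℕ) + (N + 1)).toNat = m by
      push_cast; omega, qC_gt q (by omega)]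
    simp
  · intro j hj
    by_contra hn
    apply hj
    simp only [dC]
    rw [if_neg, zero_mul]
    intro h
    exact hn ⟨(j + (N + 1)).toNat, by push_cast; omega⟩

lemma triple_product {q ζ : ℂ} (hq : ‖q‖ < 1) (q0 : q ≠ 0) (ζ0 : ζ ≠ 0) (t : ℤ → ℂ)
    (t0 : t 0 = 1) (ht : ∀ j : ℤ, t (j + 1) = -(q ^ (j + 1)) * ζ * t j) (hs : Summable t) :
    (1 - ζ⁻¹) * ∏' n : ℕ, ((1 - q ^ (n + 1) * ζ) * (1 - q ^ (n + 1) * ζ⁻¹) * (1 - q ^ (n + 1))) =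
      ∑' j, t j := by
  have hm1 := mult_one_sub hq 1
  simp only [mul_one] at hm1
  have hm := ((mult_one_sub hq ζ).mul (mult_one_sub hq ζ⁻¹)).mul hm1
  have hl := (hm.tendsto_prod_tprod_nat).const_mul (1 - ζ⁻¹)
  refine tendsto_nhds_unique hl ?_
  obtain ⟨B, hB⟩ := dC_bound hq
  have h2 : Tendsto (fun N => ∑' j : ℤ, dC q N j * t j) atTop (𝓝 (∑' j, t j)) := by
    refine tendsto_tsum_of_dominated_convergence (bound := fun j => B * ‖t j‖)
      (hs.norm.mul_left B) (fun j => ?_) (.of_forall fun N j => ?_)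
    · simpa using (dC_tendsto hq j).mul_const (t j)
    · rw [norm_mul]; gcongr; exact hB N j
  refine h2.congr fun N => ?_
  rw [dC_sum, ← finite_triple hq q0 ζ0 t t0 ht, Finset.prod_range_succ', Finset.prod_mul_distrib,
    Finset.prod_mul_distrib, qP]
  simp only [pow_zero, one_mul]
  ring

lemma norm_q_lt {τ : ℂ} (hτ : 0 < τ.im) : ‖cexp (2 * Real.pi * I * τ)‖ < 1 := by
  rw [Complex.norm_exp, Real.exp_lt_one_iff]
  simp
  positivity

/-- terms of the series of `jTheta` -/
noncomputable def hT (τ x : ℂ) (n : ℤ) : ℂ :=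
  cexp (Real.pi * I * τ / 4 + Real.pi * I * x) * jacobiTheta₂_term n (x + τ / 2 + 1 / 2) τ

lemma jTheta_eq_s5 {τ : ℂ} (hτ : 0 < τ.im) (x : ℂ) : jTheta τ x = ∑' n, hT τ x n := by
  have h := triple_product (norm_q_lt hτ) (exp_ne_zero _) (exp_ne_zero (2 * Real.pi * I * x))
    (fun n => jacobiTheta₂_term n (x + τ / 2 + 1 / 2) τ) (by simp [jacobiTheta₂_term])
    (fun j => by
      rw [← exp_int_mul, jacobiTheta₂_term, jacobiTheta₂_term, neg_mul, neg_mul, ← exp_add,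
        ← exp_add, ← neg_one_mul, ← exp_pi_mul_I, ← exp_add]
      congr 1
      push_cast
      ring)
    ((summable_jacobiTheta₂_term_iff _ _).mpr hτ)
  simp only [hT, tsum_mul_left]
  rw [← h, jTheta, exp_neg (2 * Real.pi * I * x)]
  simp only [← mul_assoc]
  congr 1
  rw [← exp_neg, mul_sub, mul_sub, mul_one, ← exp_add, ← exp_add, ← exp_add]
  ring_nf

lemma summable_hT {τ : ℂ} (hτ : 0 < τ.im) (x : ℂ) : Summable (hT τ x) :=
  ((summable_jacobiTheta₂_term_iff _ _).mpr hτ).mul_left _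

noncomputable def aT (τ x : ℂ) (n : ℤ) : ℂ :=
  jacobiTheta₂_term n (2 * x) (2 * τ)

noncomputable def bT (τ x : ℂ) (n : ℤ) : ℂ :=
  cexp (Real.pi * I * τ / 2 + 2 * Real.pi * I * x) * jacobiTheta₂_term n (2 * x + τ) (2 * τ)

lemma summable_aT {τ : ℂ} (hτ : 0 < τ.im) (x : ℂ) : Summable (aT τ x) :=
  (summable_jacobiTheta₂_term_iff _ _).mpr (by simpa using hτ)

lemma summable_bT {τ : ℂ} (hτ : 0 < τ.im) (x : ℂ) : Summable (bT τ x) :=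
  ((summable_jacobiTheta₂_term_iff _ _).mpr (by simpa using hτ)).mul_left _

def splitMap : (ℤ × ℤ) ⊕ (ℤ × ℤ) → ℤ × ℤ
  | .inl p => (p.1 + p.2, p.1 - p.2)
  | .inr p => (p.1 + p.2, p.1 - p.2 - 1)

lemma splitMap_bij : Function.Bijective splitMap := by
  constructor
  · rintro (⟨a, b⟩ | ⟨a, b⟩) (⟨c, d⟩ | ⟨c, d⟩) h <;> simp [splitMap] at h ⊢ <;> omega
  · rintro ⟨n, m⟩
    rcases Int.even_or_odd (n + m) with ⟨k, hk⟩ | ⟨k, hk⟩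
    · exact ⟨.inl (k, n - k), by simp [splitMap]; omega⟩
    · exact ⟨.inr (k + 1, n - k - 1), by simp [splitMap]; omega⟩

lemma hT_mul1 (τ x y : ℂ) (a b : ℤ) :
    hT τ (x + y) (a + b) * hT τ (x - y) (a - b) = bT τ x a * aT τ y b := by
  simp only [hT, bT, aT, jacobiTheta₂_term, ← exp_add]
  rw [exp_eq_exp_iff_exists_int]
  refine ⟨a, ?_⟩
  push_cast
  ring

lemma hT_mul2 (τ x y : ℂ) (a b : ℤ) :
    hT τ (x + y) (a + b) * hT τ (x - y) (a - b - 1) = -(aT τ x a * bT τ y b) := by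
  simp only [hT, bT, aT, jacobiTheta₂_term, ← exp_add]
  rw [← neg_one_mul, ← exp_pi_mul_I, ← exp_add, exp_eq_exp_iff_exists_int]
  refine ⟨a - 1, ?_⟩
  push_cast
  ring

lemma jTheta_mul {τ : ℂ} (hτ : 0 < τ.im) (x y : ℂ) :
    jTheta τ (x + y) * jTheta τ (x - y) =
      (∑' n, bT τ x n) * (∑' n, aT τ y n) - (∑' n, aT τ x n) * (∑' n, bT τ y n) := by
  have s1 := (summable_bT hτ x).norm
  have s2 := (summable_aT hτ y).norm
  have s3 := (summable_aT hτ x).norm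
  have s4 := (summable_bT hτ y).norm
  rw [jTheta_eq_s5 hτ, jTheta_eq_s5 hτ, tsum_mul_tsum_of_summable_norm (summable_hT hτ _).norm
    (summable_hT hτ _).norm, tsum_mul_tsum_of_summable_norm s1 s2,
    tsum_mul_tsum_of_summable_norm s3 s4, ← (Equiv.ofBijective _ splitMap_bij).tsum_eq]
  have h1 := (summable_mul_of_summable_norm s1 s2).hasSum
  have h2 := (summable_mul_of_summable_norm s3 s4).hasSum.neg
  rw [sub_eq_add_neg (∑' z : ℤ × ℤ, bT τ x z.1 * aT τ y z.2)]
  refine HasSum.tsum_eq (HasSum.sum ?_ ?_)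
  · convert h1 using 2 with p
    exact hT_mul1 τ x y p.1 p.2
  · rw [← funext fun p : ℤ × ℤ => hT_mul2 τ x y p.1 p.2] at h2
    exact h2

lemma weierstrass {τ : ℂ} (hτ : 0 < τ.im) (a b c d : ℂ) :
    jTheta τ (a + b) * jTheta τ (a - b) * (jTheta τ (c + d) * jTheta τ (c - d)) +
    jTheta τ (b + c) * jTheta τ (b - c) * (jTheta τ (a + d) * jTheta τ (a - d)) -
    jTheta τ (a + c) * jTheta τ (a - c) * (jTheta τ (b + d) * jTheta τ (b - d)) = 0 := by
  simp only [jTheta_mul hτ]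
  ring

/-- Index-67 example:
`η⁻⁶ ϑ³ϑ₂²ϑ₃²ϑ₄ϑ₅ϑ₈ = η⁻⁶ ϑ²ϑ₂²ϑ₃²ϑ₄²ϑ₅ϑ₇ − η⁻⁶ ϑ³ϑ₂ϑ₃ϑ₄²ϑ₅²ϑ₆`,
where `ϑ_j = ϑ(τ, jz)`. -/
theorem index67_example (τ : ℂ) (hτ : 0 < τ.im) (z : ℂ) :
    dedekindEta τ ^ (-6 : ℤ) *
      (jTheta τ z ^ 3 * jTheta τ (2 * z) ^ 2 * jTheta τ (3 * z) ^ 2 *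
        jTheta τ (4 * z) * jTheta τ (5 * z) * jTheta τ (8 * z)) =
    dedekindEta τ ^ (-6 : ℤ) *
      (jTheta τ z ^ 2 * jTheta τ (2 * z) ^ 2 * jTheta τ (3 * z) ^ 2 *
        jTheta τ (4 * z) ^ 2 * jTheta τ (5 * z) * jTheta τ (7 * z)) -
    dedekindEta τ ^ (-6 : ℤ) *
      (jTheta τ z ^ 3 * jTheta τ (2 * z) * jTheta τ (3 * z) *
        jTheta τ (4 * z) ^ 2 * jTheta τ (5 * z) ^ 2 * jTheta τ (6 * z)) := by
  have h := weierstrass hτ (5 * z) (3 * z) (2 * z) z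
  ring_nf at h ⊢
  linear_combination (dedekindEta τ ^ (-6 : ℤ) * jTheta τ z ^ 2 * jTheta τ (z * 2) *
    jTheta τ (z * 3) * jTheta τ (z * 4) * jTheta τ (z * 5)) * h
end
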